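/- arXiv:2007.14183 — 2 statements merged into one kernel-verified Lean document; each statement's English description precedes it below -/
import Mathlib

section
/- Suppose it is NOT the case that both R < 0 and √R ∈ ℚ(ζ). Then K = ℚ(√R·(ζ − ζ^{−1})) is a Galois extension of ℚ and Gal(K/ℚ) is isomorphic to the unit group (ℤ/nℤ)ˣ. -/
open Polynomial

section SignHom

variable {k F : Type*} [Field k] [Field F] [Algebra k F] {s : F} {R : k}

lemma algEquiv_apply_eq_or_eq_neg (hs : s ^ 2 = algebraMap k F R) (σ : F ≃ₐ[k] F) :
    σ s = s ∨ σ s = -s := by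
  rw [← sq_eq_sq_iff_eq_or_eq_neg, ← map_pow, hs, σ.commutes]

open Classical in
/-- The action of an automorphism on a square root `s` of a nonzero element of the base field,
recorded as a sign in the unit group of a commutative ring `A`. -/
noncomputable def sqrtSign [CharZero F] (A : Type*) [CommRing A] (hs : s ^ 2 = algebraMap k F R)
    (hs0 : s ≠ 0) : (F ≃ₐ[k] F) →* Aˣ where
  toFun σ := if σ s = s then 1 else -1
  map_one' := by simp
  map_mul' σ τ := by
    have hne : -s ≠ s := fun h => hs0 (self_eq_neg.mp h.symm)
    rcases algEquiv_apply_eq_or_eq_neg hs σ with h | h <;>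
      rcases algEquiv_apply_eq_or_eq_neg hs τ with h' | h' <;>
      simp [AlgEquiv.mul_apply, h, h', hne]

lemma sqrtSign_eq_one [CharZero F] {A : Type*} [CommRing A] (hs : s ^ 2 = algebraMap k F R)
    (hs0 : s ≠ 0) {σ : F ≃ₐ[k] F} (h : σ s = s) : sqrtSign A hs hs0 σ = 1 :=
  if_pos h

lemma sqrtSign_eq_neg_one [CharZero F] {A : Type*} [CommRing A] (hs : s ^ 2 = algebraMap k F R)
    (hs0 : s ≠ 0) {σ : F ≃ₐ[k] F} (h : σ s = -s) : sqrtSign A hs hs0 σ = -1 :=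
  if_neg fun h' => hs0 (self_eq_neg.mp (h'.symm.trans h))

end SignHom

section Cyclotomic

variable {F : Type*} [Field F] {n : ℕ} {z : F}

lemma IsPrimitiveRoot.pow_zmod_val_one (hz : IsPrimitiveRoot z n) :
    z ^ (1 : ZMod n).val = z := by
  rw [ZMod.val_one_eq_one_mod, ← pow_eq_pow_mod 1 hz.pow_eq_one, pow_one]

variable [NeZero n]

lemma IsPrimitiveRoot.pow_zmod_val_inj (hz : IsPrimitiveRoot z n) {a b : ZMod n} :
    z ^ a.val = z ^ b.val ↔ a = b :=
  ⟨fun h => ZMod.val_injective n (hz.pow_inj a.val_lt b.val_lt h), fun h => by rw [h]⟩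

lemma IsPrimitiveRoot.pow_zmod_val_neg_one (hz : IsPrimitiveRoot z n) :
    z ^ (-1 : ZMod n).val = z⁻¹ := by
  obtain ⟨m, rfl⟩ := Nat.exists_eq_succ_of_ne_zero (NeZero.ne n)
  rw [ZMod.val_neg_one]
  exact eq_inv_of_mul_eq_one_left (by rw [← pow_succ, hz.pow_eq_one])

variable {k : Type*} [Field k] [Algebra k F]

lemma IsPrimitiveRoot.autToPow_eq_one_iff (hz : IsPrimitiveRoot z n) (σ : F ≃ₐ[k] F) :
    hz.autToPow k σ = 1 ↔ σ z = z := by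
  rw [← hz.autToPow_spec k σ]
  nth_rewrite 4 [← hz.pow_zmod_val_one]
  rw [hz.pow_zmod_val_inj, Units.ext_iff, Units.val_one]

lemma IsPrimitiveRoot.autToPow_eq_neg_one_iff (hz : IsPrimitiveRoot z n) (σ : F ≃ₐ[k] F) :
    hz.autToPow k σ = -1 ↔ σ z = z⁻¹ := by
  rw [← hz.autToPow_spec k σ, ← hz.pow_zmod_val_neg_one, hz.pow_zmod_val_inj, Units.ext_iff,
    Units.val_neg, Units.val_one]

lemma IsPrimitiveRoot.autToPow_surjective_of_irreducible [Normal k F]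
    (hirr : Irreducible (cyclotomic n k)) (hz : IsPrimitiveRoot z n) :
    Function.Surjective (hz.autToPow k) := by
  intro u
  have hnF : NeZero (n : F) := hz.neZero'
  have : NeZero (n : k) := hnF.nat_of_neZero (algebraMap k F)
  have hu := hz.pow_of_coprime _ (ZMod.val_coe_unit_coprime u)
  have hconj : IsConjRoot k (z ^ (u : ZMod n).val) z :=
    (hu.minpoly_eq_cyclotomic_of_irreducible hirr).symm.trans
      (hz.minpoly_eq_cyclotomic_of_irreducible hirr)
  obtain ⟨σ, hσ⟩ := isConjRoot_iff_exists_algEquiv.mp hconj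
  refine ⟨σ, Units.ext ?_⟩
  rw [← hz.pow_zmod_val_inj, hz.autToPow_spec k σ, hσ]

end Cyclotomic

lemma sub_inv_eq_sub_inv_iff_of_odd_pow_eq_one {F : Type*} [Field F] [CharZero F] {n : ℕ}
    (hn : Odd n) {w z : F} (hw : w ^ n = 1) (hz : z ^ n = 1) :
    w - w⁻¹ = z - z⁻¹ ↔ w = z := by
  have hn0 : n ≠ 0 := hn.pos.ne'
  have hw0 : w ≠ 0 := by rintro rfl; simp [hn0] at hw
  have hz0 : z ≠ 0 := by rintro rfl; simp [hn0] at hz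
  refine ⟨fun h => ?_, fun h => by rw [h]⟩
  have h1 : (w - z) * (w * z + 1) = 0 := by
    field_simp at h
    linear_combination h
  rcases mul_eq_zero.mp h1 with h2 | h2
  · exact sub_eq_zero.mp h2
  · have h3 : (w * z) ^ n = -1 := by rw [eq_neg_of_add_eq_zero_left h2, hn.neg_one_pow]
    rw [mul_pow, hw, hz, one_mul] at h3
    norm_num [eq_neg_iff_add_eq_zero] at h3

section Generic

variable {k F : Type*} [Field k] [Field F] [Algebra k F] [CharZero F] {s z : F} {R : k} {n : ℕ} [NeZero n]

/-- The cyclotomic character twisted by the quadratic character of `s = √R`. -/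
noncomputable def twistedCyclotomicCharacter (hs : s ^ 2 = algebraMap k F R) (hs0 : s ≠ 0)
    (hz : IsPrimitiveRoot z n) : (F ≃ₐ[k] F) →* (ZMod n)ˣ :=
  sqrtSign (ZMod n) hs hs0 * hz.autToPow k

lemma twistedCyclotomicCharacter_eq_one_iff (hn : Odd n) (hs : s ^ 2 = algebraMap k F R) (hs0 : s ≠ 0)
    (hz : IsPrimitiveRoot z n) (σ : F ≃ₐ[k] F) :
    twistedCyclotomicCharacter hs hs0 hz σ = 1 ↔ σ (s * (z - z⁻¹)) = s * (z - z⁻¹) := by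
  have hσz : (σ z) ^ n = 1 := by rw [← map_pow, hz.pow_eq_one, map_one]
  have hz' : (z⁻¹) ^ n = 1 := by rw [inv_pow, hz.pow_eq_one, inv_one]
  rw [twistedCyclotomicCharacter, MonoidHom.mul_apply, map_mul, map_sub, map_inv₀]
  rcases algEquiv_apply_eq_or_eq_neg hs σ with h | h
  · rw [sqrtSign_eq_one hs hs0 h, one_mul, hz.autToPow_eq_one_iff, h, mul_right_inj' hs0,
      sub_inv_eq_sub_inv_iff_of_odd_pow_eq_one hn hσz hz.pow_eq_one]
  · rw [sqrtSign_eq_neg_one hs hs0 h, neg_one_mul, neg_eq_iff_eq_neg, hz.autToPow_eq_neg_one_iff, h,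
      neg_mul, ← mul_neg, mul_right_inj' hs0, neg_eq_iff_eq_neg, neg_sub,
      ← sub_inv_eq_sub_inv_iff_of_odd_pow_eq_one hn hσz hz', inv_inv]

lemma twistedCyclotomicCharacter_surjective [Normal k F]
    (hirr : Irreducible (cyclotomic n k)) (hs : s ^ 2 = algebraMap k F R) (hs0 : s ≠ 0)
    (hz : IsPrimitiveRoot z n) {c : F ≃ₐ[k] F}
    (hc : twistedCyclotomicCharacter hs hs0 hz c = -1) :
    Function.Surjective (twistedCyclotomicCharacter hs hs0 hz) := by
  intro u
  obtain ⟨σ, rfl⟩ := hz.autToPow_surjective_of_irreducible hirr u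
  rcases algEquiv_apply_eq_or_eq_neg hs σ with h | h
  · exact ⟨σ, by simp [twistedCyclotomicCharacter, sqrtSign_eq_one hs hs0 h]⟩
  · refine ⟨c * σ, ?_⟩
    rw [map_mul, hc]
    simp [twistedCyclotomicCharacter, sqrtSign_eq_neg_one hs hs0 h]

lemma exists_twistedCyclotomicCharacter_eq_neg_one_of_notMem [IsGalois k F]
    (hs : s ^ 2 = algebraMap k F R) (hs0 : s ≠ 0) (hz : IsPrimitiveRoot z n)
    (hmem : s ∉ IntermediateField.adjoin k ({z} : Set F)) :
    ∃ c, twistedCyclotomicCharacter hs hs0 hz c = -1 := by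
  rw [← InfiniteGalois.fixedField_fixingSubgroup (IntermediateField.adjoin k ({z} : Set F)),
    IntermediateField.mem_fixedField_iff] at hmem
  push Not at hmem
  obtain ⟨c, hc, hcs⟩ := hmem
  have hcz : c z = z := (IntermediateField.mem_fixingSubgroup_iff _ _).mp hc z
    (IntermediateField.mem_adjoin_simple_self k z)
  refine ⟨c, ?_⟩
  rw [twistedCyclotomicCharacter, MonoidHom.mul_apply, (hz.autToPow_eq_one_iff c).mpr hcz,
    sqrtSign_eq_neg_one hs hs0 ((algEquiv_apply_eq_or_eq_neg hs c).resolve_left hcs), mul_one]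

theorem isGalois_and_nonempty_mulEquiv_of_ker_eq_fixingSubgroup {k F G : Type*} [Field k] [Field F]
    [Algebra k F] [IsGalois k F] [Group G] (K : IntermediateField k F) (ψ : (F ≃ₐ[k] F) →* G)
    (hψ : Function.Surjective ψ) (hK : ψ.ker = K.fixingSubgroup) :
    IsGalois k K ∧ Nonempty ((K ≃ₐ[k] K) ≃* G) := by
  have hgal : IsGalois k K :=
    (InfiniteGalois.normal_iff_isGalois K).mp (hK ▸ inferInstance)
  refine ⟨hgal, ⟨?_⟩⟩
  have hker : (AlgEquiv.restrictNormalHom (F := k) (K₁ := F) K).ker = ψ.ker := by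
    rw [IntermediateField.restrictNormalHom_ker, hK]
  exact (QuotientGroup.quotientKerEquivOfSurjective _
    (AlgEquiv.restrictNormalHom_surjective F)).symm.trans (QuotientGroup.liftEquiv _ hψ hker)

theorem isGalois_adjoin_sqrt_mul_sub_inv [IsGalois k F] (hn : Odd n)
    (hirr : Irreducible (cyclotomic n k)) (hs : s ^ 2 = algebraMap k F R)
    (hs0 : s ≠ 0) (hz : IsPrimitiveRoot z n)
    (hc : ∃ c, twistedCyclotomicCharacter hs hs0 hz c = -1) :
    IsGalois k (IntermediateField.adjoin k ({s * (z - z⁻¹)} : Set F)) ∧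
      Nonempty ((IntermediateField.adjoin k ({s * (z - z⁻¹)} : Set F) ≃ₐ[k]
        IntermediateField.adjoin k ({s * (z - z⁻¹)} : Set F)) ≃* (ZMod n)ˣ) := by
  obtain ⟨c, hc⟩ := hc
  refine isGalois_and_nonempty_mulEquiv_of_ker_eq_fixingSubgroup _
    (twistedCyclotomicCharacter hs hs0 hz) (twistedCyclotomicCharacter_surjective hirr hs hs0 hz hc) ?_
  ext σ
  rw [MonoidHom.mem_ker, twistedCyclotomicCharacter_eq_one_iff hn,
    IntermediateField.mem_fixingSubgroup_iff]
  simpa using (IntermediateField.forall_mem_adjoin_smul_eq_self_iff k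
    (S := {s * (z - z⁻¹)}) σ).symm

end Generic

theorem isGalois_adjoin_sqrt_mul_sub_inv_of_isAlgClosed {k E : Type*} [Field k] [CharZero k]
    [Field E] [Algebra k E] [IsAlgClosed E] {n : ℕ} (hn : Odd n)
    (hirr : Irreducible (cyclotomic n k)) {R : k} {s z : E} (hs : s ^ 2 = algebraMap k E R)
    (hs0 : s ≠ 0) (hz : IsPrimitiveRoot z n)
    (hc : s ∉ IntermediateField.adjoin k ({z} : Set E) ∨ ∃ c : E ≃ₐ[k] E, c s = s ∧ c z = z⁻¹)
    (K : IntermediateField k E)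
    (hK : K = IntermediateField.adjoin k ({s * (z - z⁻¹)} : Set E)) :
    IsGalois k K ∧ Nonempty ((K ≃ₐ[k] K) ≃* (ZMod n)ˣ) := by
  have : NeZero n := ⟨hn.pos.ne'⟩
  let L := algebraicClosure k E
  have : IsAlgClosure k L := algebraicClosure.isAlgClosure k E
  have : Normal k L := IsAlgClosure.normal k L
  have : IsGalois k L := ⟨⟩
  have : CharZero L := charZero_of_injective_algebraMap (algebraMap k L).injective
  have hsL : s ∈ L := mem_algebraicClosure_iff.mpr
    (IsAlgebraic.of_pow two_pos (hs ▸ isAlgebraic_algebraMap R))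
  have hzL : z ∈ L := mem_algebraicClosure_iff.mpr
    (IsAlgebraic.of_pow hn.pos (hz.pow_eq_one ▸ isAlgebraic_one))
  let s' : L := ⟨s, hsL⟩
  let z' : L := ⟨z, hzL⟩
  have hs' : s' ^ 2 = algebraMap k L R := Subtype.ext hs
  have hs0' : s' ≠ 0 := fun h => hs0 (congrArg Subtype.val h)
  have hz' : IsPrimitiveRoot z' n :=
    IsPrimitiveRoot.of_map_of_injective (f := L.val) hz L.val.injective
  have hc' : ∃ c, twistedCyclotomicCharacter hs' hs0' hz' c = -1 := by
    rcases hc with hmem | ⟨c, hcs, hcz⟩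
    · refine exists_twistedCyclotomicCharacter_eq_neg_one_of_notMem hs' hs0' hz' fun h => hmem ?_
      rw [← IntermediateField.mem_lift, IntermediateField.lift_adjoin_simple] at h
      exact h
    · have hcL (x : L) : (c.restrictNormal L x : E) = c x := c.restrictNormal_commutes L x
      have hcs' : c.restrictNormal L s' = s' := Subtype.ext ((hcL s').trans hcs)
      have hcz' : c.restrictNormal L z' = z'⁻¹ := Subtype.ext ((hcL z').trans hcz)
      refine ⟨c.restrictNormal L, ?_⟩
      rw [twistedCyclotomicCharacter, MonoidHom.mul_apply, sqrtSign_eq_one hs' hs0' hcs',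
        (hz'.autToPow_eq_neg_one_iff _).mpr hcz', one_mul]
  obtain ⟨hgal, ⟨e⟩⟩ := isGalois_adjoin_sqrt_mul_sub_inv hn hirr hs' hs0' hz' hc'
  have hlift : IntermediateField.lift
      (IntermediateField.adjoin k ({s' * (z' - z'⁻¹)} : Set L)) = K := by
    rw [IntermediateField.lift_adjoin_simple, hK]
    rfl
  subst hlift
  let f := IntermediateField.liftAlgEquiv
    (IntermediateField.adjoin k ({s' * (z' - z'⁻¹)} : Set L))
  exact ⟨IsGalois.of_algEquiv f, ⟨(AlgEquiv.autCongr f).symm.trans e⟩⟩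

lemma Complex.conj_eq_self_of_sq_eq_ratCast {s : ℂ} {R : ℚ} (hR : 0 < R) (hs : s ^ 2 = (R : ℂ)) :
    (starRingEnd ℂ) s = s := by
  have hre := congrArg Complex.re hs
  have him := congrArg Complex.im hs
  simp only [pow_two, Complex.mul_re, Complex.mul_im, Complex.ratCast_re, Complex.ratCast_im]
    at hre him
  have hR' : (0 : ℝ) < R := by exact_mod_cast hR
  rw [Complex.conj_eq_iff_im]
  by_contra him0
  have hre0 : s.re = 0 := by
    rcases mul_eq_zero.mp (show s.re * s.im = 0 by linarith) with h | h
    · exact h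
    · exact absurd h him0
  rw [hre0] at hre
  nlinarith [mul_self_nonneg s.im]

/-- **Proposition 4, generic case.**  Let `n ≥ 3` be odd and `R ∈ ℚ` a nonzero rational that
is not a square.  If it is not the case that both `R < 0` and `√R ∈ ℚ(ζ)`, then
`K = ℚ(√R(ζ - ζ⁻¹))` is Galois over ℚ with Galois group isomorphic to `(ℤ/nℤ)ˣ`. -/
theorem galK_generic
    (n : ℕ) (hn3 : 3 ≤ n) (hodd : Odd n)
    (R : ℚ) (hR0 : R ≠ 0) (hR : ¬ IsSquare R)
    (sqrtR : ℂ) (hsR : sqrtR ^ 2 = (R : ℂ))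
    (ζ : ℂ) (hζ : IsPrimitiveRoot ζ n)
    (hexc : ¬ (R < 0 ∧ sqrtR ∈ IntermediateField.adjoin ℚ ({ζ} : Set ℂ)))
    (K : IntermediateField ℚ ℂ)
    (hK : K = IntermediateField.adjoin ℚ ({sqrtR * (ζ - ζ⁻¹)} : Set ℂ)) :
    IsGalois ℚ K ∧ Nonempty ((K ≃ₐ[ℚ] K) ≃* (ZMod n)ˣ) := by
  have hn0 : n ≠ 0 := by lia
  have hs0 : sqrtR ≠ 0 := by
    rintro rfl
    rw [zero_pow two_ne_zero] at hsR
    exact hR0 (by exact_mod_cast hsR.symm)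
  have hc : sqrtR ∉ IntermediateField.adjoin ℚ ({ζ} : Set ℂ) ∨
      ∃ c : ℂ ≃ₐ[ℚ] ℂ, c sqrtR = sqrtR ∧ c ζ = ζ⁻¹ := by
    rcases lt_or_gt_of_ne hR0 with hneg | hpos
    · exact Or.inl fun h => hexc ⟨hneg, h⟩
    · exact Or.inr ⟨Complex.conjAe.restrictScalars ℚ,
        Complex.conj_eq_self_of_sq_eq_ratCast hpos hsR,
        (Complex.inv_eq_conj (hζ.norm'_eq_one hn0)).symm⟩
  have h := isGalois_adjoin_sqrt_mul_sub_inv_of_isAlgClosed hodd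
    (cyclotomic.irreducible_rat hodd.pos) hsR hs0 hζ hc K hK
  have halg : DivisionRing.toRatAlgebra = K.algebra' := Subsingleton.elim _ _
  rw [halg]
  exact h
end

section
/- Let n = p be a prime number with p ≥ 3. If f_p = f_p(Z,d,R) has no rational root, then f_p is irreducible in ℚ[Z]. -/
open Polynomial

/-- The De Moivre polynomial
`f_n(Z,d,R) = Σ_{k=0}^{(n-1)/2} (-1)^k (n/(n-k)) C(n-k,k) D^k Z^{n-2k} - d D^{(n-1)/2}`,
where `D = d² - R`. -/
noncomputable def deMoivre (n : ℕ) (d R : ℚ) : ℚ[X] :=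
  (∑ k ∈ Finset.range ((n - 1) / 2 + 1),
      C ((-1 : ℚ) ^ k * ((n : ℚ) / ((n : ℚ) - (k : ℚ))) * ((n - k).choose k : ℚ)
          * (d ^ 2 - R) ^ k) * X ^ (n - 2 * k))
    - C (d * (d ^ 2 - R) ^ ((n - 1) / 2))

/-- The Pascal-type recursion of the Lucas triangle `n / (n - k) * C(n - k, k)`. -/
lemma lucas_coeff_succ {n k : ℕ} (hn : 1 ≤ n) (hk : k ≤ n) :
    (((n + 2 : ℕ) : ℚ) / (((n + 2 : ℕ) : ℚ) - ((k + 1 : ℕ) : ℚ))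
        * ((n + 2 - (k + 1)).choose (k + 1) : ℚ))
      = ((n + 1 : ℕ) : ℚ) / (((n + 1 : ℕ) : ℚ) - ((k + 1 : ℕ) : ℚ))
          * ((n + 1 - (k + 1)).choose (k + 1) : ℚ)
        + (n : ℚ) / ((n : ℚ) - (k : ℚ)) * ((n - k).choose k : ℚ) := by
  obtain ⟨m, rfl⟩ := Nat.exists_eq_add_of_le' hk
  rw [show m + k + 2 - (k + 1) = m + 1 by omega, show m + k + 1 - (k + 1) = m by omega,
    show m + k - k = m by omega]
  rcases Nat.eq_zero_or_pos m with rfl | hm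
  · obtain ⟨j, rfl⟩ := Nat.exists_eq_add_of_le' (show 1 ≤ k by omega)
    simp [Nat.choose_eq_zero_of_lt]
  · have hm0 : (m : ℚ) ≠ 0 := by positivity
    have hm1 : (m : ℚ) + 1 ≠ 0 := by positivity
    have hle : (m.choose (k + 1) : ℚ) * (k + 1) = m.choose k * (m - k) := by
      rcases le_or_gt k m with h | h
      · have := Nat.choose_succ_right_eq m k
        rw [← Nat.cast_sub h]
        exact_mod_cast this
      · simp [Nat.choose_eq_zero_of_lt h, Nat.choose_eq_zero_of_lt (h.trans (Nat.lt_succ_self k))]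
    have h₁ : ((m + k + 2 : ℕ) : ℚ) - ((k + 1 : ℕ) : ℚ) = m + 1 := by push_cast; ring
    have h₂ : ((m + k + 1 : ℕ) : ℚ) - ((k + 1 : ℕ) : ℚ) = m := by push_cast; ring
    have h₃ : ((m + k : ℕ) : ℚ) - (k : ℚ) = m := by push_cast; ring
    rw [h₁, h₂, h₃, Nat.choose_succ_succ]
    push_cast
    field_simp
    linear_combination -hle

/-- Waring's formula: `uⁿ + vⁿ` in terms of `u + v` and `u * v`. -/
lemma waring_pow_add_pow {F : Type*} [Field F] [Algebra ℚ F] (u v : F) {n : ℕ} (hn : 1 ≤ n) :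
    ∑ k ∈ Finset.range (n + 1),
      algebraMap ℚ F ((n : ℚ) / ((n : ℚ) - (k : ℚ)) * ((n - k).choose k : ℚ))
        * (-(u * v)) ^ k * (u + v) ^ (n - 2 * k) = u ^ n + v ^ n := by
  induction n using Nat.strong_induction_on with
  | _ n ih =>
    match n, hn with
    | 1, _ => simp [Finset.sum_range_succ]
    | 2, _ =>
      have : (2 : ℚ) / (2 - 1) = 2 := by norm_num
      simp [Finset.sum_range_succ, this]
      ring
    | n + 3, _ =>
      have h₁ := ih (n + 1) (by omega) (by omega)
      have h₂ := ih (n + 2) (by omega) (by omega)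
      have hstep : u ^ (n + 3) + v ^ (n + 3) = (u + v) * (u ^ (n + 2) + v ^ (n + 2))
          + (-(u * v)) * (u ^ (n + 1) + v ^ (n + 1)) := by ring
      rw [hstep, ← h₁, ← h₂, Finset.sum_range_succ', Finset.sum_range_succ,
        Finset.sum_range_succ' _ (n + 2), mul_add (u + v), Finset.mul_sum, Finset.mul_sum]
      have hlast : (n + 3 - (n + 2 + 1)).choose (n + 2 + 1) = 0 := by simp
      rw [hlast]
      have hn2 : ((n + 2 : ℕ) : ℚ) ≠ 0 := by positivity
      have hn3 : ((n + 3 : ℕ) : ℚ) ≠ 0 := by positivity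
      have hsum : ∀ k ∈ Finset.range (n + 2),
          algebraMap ℚ F (((n + 3 : ℕ) : ℚ) / (((n + 3 : ℕ) : ℚ) - ((k + 1 : ℕ) : ℚ))
              * ((n + 3 - (k + 1)).choose (k + 1) : ℚ))
            * (-(u * v)) ^ (k + 1) * (u + v) ^ (n + 3 - 2 * (k + 1))
          = (u + v) * (algebraMap ℚ F (((n + 2 : ℕ) : ℚ) / (((n + 2 : ℕ) : ℚ) - ((k + 1 : ℕ) : ℚ))
              * ((n + 2 - (k + 1)).choose (k + 1) : ℚ))
            * (-(u * v)) ^ (k + 1) * (u + v) ^ (n + 2 - 2 * (k + 1)))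
          + (-(u * v)) * (algebraMap ℚ F (((n + 1 : ℕ) : ℚ) / (((n + 1 : ℕ) : ℚ) - (k : ℚ))
              * ((n + 1 - k).choose k : ℚ))
            * (-(u * v)) ^ k * (u + v) ^ (n + 1 - 2 * k)) := by
        intro k hk
        have hk' : k ≤ n + 1 := by have := Finset.mem_range.mp hk; omega
        rw [lucas_coeff_succ (by omega) hk', map_add,
          show n + 3 - 2 * (k + 1) = n + 1 - 2 * k by omega]
        rcases le_or_gt (2 * (k + 1)) (n + 2) with h | h
        · rw [show n + 1 - 2 * k = (n + 2 - 2 * (k + 1)) + 1 by omega]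
          ring
        · rw [Nat.choose_eq_zero_of_lt (show n + 2 - (k + 1) < k + 1 by omega)]
          simp only [Nat.cast_zero, mul_zero, map_zero, zero_mul, zero_add]
          ring
      rw [Finset.sum_congr rfl hsum, Finset.sum_add_distrib]
      simp only [Nat.cast_zero, sub_zero, tsub_zero, mul_zero, map_zero, zero_mul, add_zero,
        Nat.choose_zero_right, Nat.cast_one, mul_one, pow_zero, div_self hn2, div_self hn3, map_one]
      ring

lemma aeval_deMoivre {F : Type*} [Field F] [Algebra ℚ F] {n : ℕ} (hn : Odd n) (d R : ℚ)
    {u v : F} (huv : u * v = algebraMap ℚ F (d ^ 2 - R)) :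
    aeval (u + v) (deMoivre n d R)
      = u ^ n + v ^ n - algebraMap ℚ F (d * (d ^ 2 - R) ^ ((n - 1) / 2)) := by
  obtain ⟨m, rfl⟩ := hn
  rw [← waring_pow_add_pow u v (show 1 ≤ 2 * m + 1 by omega), deMoivre, map_sub, aeval_C, map_sum]
  congr 1
  rw [show (2 * m + 1 - 1) / 2 + 1 = m + 1 by omega]
  have hsub : Finset.range (m + 1) ⊆ Finset.range (2 * m + 1 + 1) :=
    Finset.range_subset_range.mpr (by omega)
  rw [← Finset.sum_subset hsub]
  · refine Finset.sum_congr rfl fun k _ => ?_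
    rw [map_mul, aeval_C, map_pow, aeval_X, huv]
    simp only [map_mul, map_pow, map_neg, map_one, neg_pow (algebraMap ℚ F (d ^ 2 - R))]
    ring
  · intro k _ hk
    rw [Finset.mem_range, not_lt] at hk
    rw [Nat.choose_eq_zero_of_lt (show 2 * m + 1 - k < k by omega)]
    simp

lemma natDegree_deMoivre_le (n : ℕ) (d R : ℚ) : (deMoivre n d R).natDegree ≤ n := by
  refine (natDegree_sub_le _ _).trans (max_le ?_ (by rw [natDegree_C]; exact Nat.zero_le n))
  refine natDegree_sum_le_of_forall_le _ _ fun k _ => ?_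
  exact (natDegree_C_mul_X_pow_le _ _).trans (Nat.sub_le _ _)

lemma exists_add_mul_of_mem_adjoin_quadratic {F : Type*} [Field F] [Algebra ℚ F] {t s : F}
    {b c : ℚ} (ht : aeval t (X ^ 2 - C b * X + C c) = 0) (hs : s ∈ IntermediateField.adjoin ℚ {t}) :
    ∃ x y : ℚ, s = aeval t (C y * X + C x) := by
  have hmonic : (X ^ 2 - C b * X + C c : ℚ[X]).Monic := by monicity!
  have hint : IsIntegral ℚ t := ⟨_, hmonic, ht⟩
  rw [← IntermediateField.mem_toSubalgebra,
    IntermediateField.adjoin_simple_toSubalgebra_of_isAlgebraic hint.isAlgebraic,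
    Algebra.adjoin_singleton_eq_range_aeval] at hs
  obtain ⟨g, rfl⟩ := hs
  have hdeg : (g %ₘ (X ^ 2 - C b * X + C c)).natDegree ≤ 1 := by
    have h2 : (X ^ 2 - C b * X + C c : ℚ[X]).natDegree = 2 := by compute_degree!
    have := natDegree_modByMonic_lt g hmonic (fun h => by simp [h] at h2)
    omega
  obtain ⟨y, x, h⟩ := exists_eq_X_add_C_of_natDegree_le_one hdeg
  refine ⟨x, y, ?_⟩
  rw [← h]
  exact (aeval_modByMonic_eq_self_of_root ht).symm

/-- If a root `t` of `X² - cX + Dᵖ` is a `p`-th power in `ℚ(t)`, then `t = uᵖ` and `c - t = vᵖ`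
for some `u, v` with rational sum and with product `D`. -/
lemma exists_rational_add_of_pow_eq {F : Type*} [Field F] [Algebra ℚ F] {p : ℕ} (hp : Odd p)
    {D c : ℚ} {t s : F} (ht0 : t ≠ 0) (ht : aeval t (X ^ 2 - C c * X + C (D ^ p)) = 0)
    (hs : s ∈ IntermediateField.adjoin ℚ {t}) (hst : s ^ p = t) :
    ∃ (q : ℚ) (u v : F), u + v = algebraMap ℚ F q ∧ u * v = algebraMap ℚ F D ∧
      u ^ p + v ^ p = algebraMap ℚ F c := by
  obtain ⟨x, y, rfl⟩ := exists_add_mul_of_mem_adjoin_quadratic ht hs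
  have hprod : t * (algebraMap ℚ F c - t) = algebraMap ℚ F D ^ p := by
    simp [-eq_ratCast] at ht
    linear_combination -ht
  have hp0 : p ≠ 0 := hp.pos.ne'
  by_cases hrat : t ∈ (algebraMap ℚ F).range
  · obtain ⟨r, rfl⟩ := hrat
    rw [aeval_algebraMap_apply] at hst
    set s := aeval r (C y * X + C x)
    have hs0 : algebraMap ℚ F s ≠ 0 := fun h => ht0 (by rw [← hst, h, zero_pow hp0])
    refine ⟨s + D / s, algebraMap ℚ F s, algebraMap ℚ F (D / s), (map_add _ _ _).symm, ?_, ?_⟩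
    · rw [map_div₀]
      field_simp
    · rw [hst, map_div₀, div_pow, hst, ← hprod]
      field_simp
      ring
  · have hmonic : (X ^ 2 - C c * X + C (D ^ p) : ℚ[X]).Monic := by monicity!
    have h2 : (X ^ 2 - C c * X + C (D ^ p) : ℚ[X]).natDegree = 2 := by compute_degree!
    have hint : IsIntegral ℚ t := ⟨_, hmonic, ht⟩
    have hmin : minpoly ℚ t = X ^ 2 - C c * X + C (D ^ p) := by
      refine (eq_of_monic_of_associated (minpoly.monic hint) hmonic
        (associated_of_dvd_of_natDegree_le (minpoly.dvd ℚ t ht) hmonic.ne_zero ?_))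
      rw [h2]
      exact (minpoly.two_le_natDegree_iff hint).mpr hrat
    have hconj : aeval (algebraMap ℚ F c - t) (minpoly ℚ t) = 0 := by
      rw [hmin]
      simp [-eq_ratCast] at ht ⊢
      linear_combination ht
    have hdvd : minpoly ℚ t ∣ (C y * X + C x) ^ p - X := by
      apply minpoly.dvd
      rw [map_sub, map_pow, hst, aeval_X, sub_self]
    have hst' : aeval (algebraMap ℚ F c - t) (C y * X + C x) ^ p = algebraMap ℚ F c - t := by
      have := aeval_eq_zero_of_dvd_aeval_eq_zero hdvd hconj
      rwa [map_sub, map_pow, aeval_X, sub_eq_zero] at this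
    refine ⟨y * c + (x + x), aeval t (C y * X + C x), aeval (algebraMap ℚ F c - t) (C y * X + C x),
      ?_, ?_, ?_⟩
    · simp [-eq_ratCast]
      ring
    · have hmul : aeval t (C y * X + C x) * aeval (algebraMap ℚ F c - t) (C y * X + C x)
          = algebraMap ℚ F (y ^ 2 * D ^ p + x * y * c + x ^ 2) := by
        simp [-eq_ratCast]
        linear_combination (algebraMap ℚ F y) ^ 2 * hprod
      have hpow : (y ^ 2 * D ^ p + x * y * c + x ^ 2) ^ p = D ^ p := by
        apply (algebraMap ℚ F).injective
        rw [map_pow, ← hmul, mul_pow, hst, hst', hprod, map_pow]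
      rw [hmul, hp.strictMono_pow.injective hpow]
    · rw [hst, hst']
      ring

/-- If `uᵖ ∈ K` is not a `p`-th power in `K`, then `u + D / u` has degree `p` over `K`. -/
lemma natDegree_minpoly_add_div_of_prime {K F : Type*} [Field K] [Field F] [Algebra K F] {p : ℕ}
    (hp : p.Prime) (hp3 : 3 ≤ p) {a D : K} {u : F} (hu0 : u ≠ 0) (hu : u ^ p = algebraMap K F a)
    (ha : ∀ b : K, b ^ p ≠ a) :
    (minpoly K (u + algebraMap K F D / u)).natDegree = p := by
  have hirr := X_pow_sub_C_irreducible_of_prime hp ha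
  have hmin : minpoly K u = X ^ p - C a :=
    (minpoly.eq_of_irreducible_of_monic hirr (by simp [hu]) (monic_X_pow_sub_C _ hp.ne_zero)).symm
  have hint : IsIntegral K u := ⟨_, monic_X_pow_sub_C a hp.ne_zero, by simp [hu]⟩
  have hdeg : (minpoly K u).natDegree = p := by rw [hmin, natDegree_X_pow_sub_C]
  have hfin : Module.finrank K (IntermediateField.adjoin K {u}) = p := by
    rw [IntermediateField.adjoin.finrank hint, hdeg]
  have : FiniteDimensional K (IntermediateField.adjoin K {u}) :=
    IntermediateField.adjoin.finiteDimensional hint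
  have hmem : u + algebraMap K F D / u ∈ IntermediateField.adjoin K {u} := by
    have := IntermediateField.mem_adjoin_simple_self K u
    exact add_mem this (div_mem (algebraMap_mem _ D) this)
  have hz : minpoly K (⟨_, hmem⟩ : IntermediateField.adjoin K {u})
      = minpoly K (u + algebraMap K F D / u) :=
    (minpoly.algebraMap_eq (IntermediateField.adjoin K {u}).val.injective _).symm
  have hzint : IsIntegral K (u + algebraMap K F D / u) := by
    have := (IsIntegral.of_finite K (⟨_, hmem⟩ : IntermediateField.adjoin K {u}))
    exact this.map (IntermediateField.adjoin K {u}).val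
  have hdvd := minpoly.degree_dvd (IsIntegral.of_finite K
    (⟨_, hmem⟩ : IntermediateField.adjoin K {u}))
  rw [hz, hfin] at hdvd
  refine ((Nat.dvd_prime hp).mp hdvd).resolve_left fun h1 => ?_
  obtain ⟨z, hz⟩ := minpoly.natDegree_eq_one_iff.mp h1
  have hroot : aeval u (X ^ 2 - C z * X + C D) = 0 := by
    simp [hz]
    field_simp
    ring
  have h2 : (X ^ 2 - C z * X + C D : K[X]).natDegree = 2 := by compute_degree!
  have := natDegree_le_of_dvd (minpoly.dvd K u hroot) (fun h => by simp [h] at h2)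
  omega

/-- **Theorem 4.**  Let `p ≥ 3` be a prime, `d, R ∈ ℚ`, `d ≠ 0`, `R` not a square.  If
`f_p = f_p(Z,d,R)` has no rational root, then `f_p` is irreducible in `ℚ[Z]`. -/
theorem deMoivre_prime_irreducible_of_no_rational_root
    (p : ℕ) (hp : p.Prime) (hp3 : 3 ≤ p)
    (d R : ℚ) (hd : d ≠ 0) (hR : ¬ IsSquare R)
    (hnoroot : ¬ ∃ q : ℚ, (deMoivre p d R).IsRoot q) :
    Irreducible (deMoivre p d R) := by
  have hodd : Odd p := hp.odd_of_ne_two (by omega)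
  set D := d ^ 2 - R with hD
  set c := d * D ^ ((p - 1) / 2) with hc
  have hne : deMoivre p d R ≠ 0 := fun h => hnoroot ⟨0, by simp [h]⟩
  have hD0 : D ≠ 0 := by
    intro h
    refine hnoroot ⟨0, ?_⟩
    have := aeval_deMoivre (F := ℚ) hodd d R (u := 0) (v := 0) (by simp [← hD, h])
    rw [← hD, h, zero_pow (by omega : (p - 1) / 2 ≠ 0)] at this
    simpa [hp.ne_zero] using this
  obtain ⟨t, ht⟩ := IsAlgClosed.exists_aeval_eq_zero (AlgebraicClosure ℚ)
    (X ^ 2 - C c * X + C (D ^ p)) (by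
      have h2 : (X ^ 2 - C c * X + C (D ^ p) : ℚ[X]).degree = 2 := by compute_degree!
      rw [h2]
      decide)
  have ht0 : t ≠ 0 := by
    rintro rfl
    simp [hD0] at ht
  obtain ⟨u, hu⟩ := IsAlgClosed.exists_pow_nat_eq t hp.pos
  have hu0 : u ≠ 0 := by
    rintro rfl
    exact ht0 (by rw [← hu, zero_pow hp.ne_zero])
  have hz : aeval (u + algebraMap ℚ _ D / u) (deMoivre p d R) = 0 := by
    rw [aeval_deMoivre hodd d R (by rw [mul_div_cancel₀ _ hu0]), div_pow, hu, ← hD, ← hc]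
    simp [-eq_ratCast] at ht
    field_simp
    linear_combination ht
  let K := IntermediateField.adjoin ℚ {t}
  have hnpow : ∀ b : K, b ^ p ≠ IntermediateField.AdjoinSimple.gen ℚ t := by
    intro b hb
    obtain ⟨q, v, w, hadd, hmul, hpow⟩ := exists_rational_add_of_pow_eq hodd ht0 ht b.2
      (by simpa using congrArg (algebraMap K (AlgebraicClosure ℚ)) hb)
    refine hnoroot ⟨q, (algebraMap ℚ (AlgebraicClosure ℚ)).injective ?_⟩
    have := aeval_deMoivre hodd d R hmul
    rw [hadd, hpow, ← hD, ← hc, sub_self, aeval_algebraMap_apply, coe_aeval_eq_eval] at this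
    rw [this, map_zero]
  have hdegK := natDegree_minpoly_add_div_of_prime (K := K) (D := algebraMap ℚ K D) hp hp3 hu0
    (by simpa using hu) hnpow
  rw [← IsScalarTower.algebraMap_apply] at hdegK
  set z := u + algebraMap ℚ (AlgebraicClosure ℚ) D / u
  have hzint : IsIntegral ℚ z := IsAlgebraic.isIntegral ⟨_, hne, hz⟩
  have hdeg : p ≤ (minpoly ℚ z).natDegree := by
    rw [← hdegK, ← natDegree_map (algebraMap ℚ K) (p := minpoly ℚ z)]
    exact natDegree_le_of_dvd (minpoly.dvd_map_of_isScalarTower ℚ K z)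
      (map_ne_zero (minpoly.ne_zero hzint))
  have hassoc : Associated (minpoly ℚ z) (deMoivre p d R) :=
    associated_of_dvd_of_natDegree_le (minpoly.dvd ℚ z hz) hne
      ((natDegree_deMoivre_le p d R).trans hdeg)
  exact hassoc.irreducible (minpoly.irreducible hzint)
end
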